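/- arXiv:2312.16841 — 3 statements merged into one kernel-verified Lean document; each statement's English description precedes it below -/
import Mathlib

section
/- Let D be a weighted oriented graph and let f_n ∈ I_D be a pure binomial. Then the support supp(f_n) does not contain any edge of D incident with a leaf (a vertex of degree 1) of D. -/
open MvPolynomial Finset

/-- The "positive part" `∏ e, X e ^ (b e)⁺` of the binomial associated to an
integer vector `b`. -/
noncomputable def binomPlus (K : Type*) [Field K] {ι : Type*} [Fintype ι]
    (b : ι → ℤ) : MvPolynomial ι K :=
  ∏ e, X e ^ (b e).toNat

/-- The "negative part" `∏ e, X e ^ (b e)⁻` of the binomial associated to an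
integer vector `b`. -/
noncomputable def binomMinus (K : Type*) [Field K] {ι : Type*} [Fintype ι]
    (b : ι → ℤ) : MvPolynomial ι K :=
  ∏ e, X e ^ (-b e).toNat

/-- The (pure) binomial `f_b = f_b⁺ - f_b⁻` associated to an integer vector `b`. -/
noncomputable def binom (K : Type*) [Field K] {ι : Type*} [Fintype ι]
    (b : ι → ℤ) : MvPolynomial ι K :=
  binomPlus K b - binomMinus K b

/-- Support of an integer vector. -/
def vsupp {ι : Type*} (b : ι → ℤ) : Set ι := {e | b e ≠ 0}

/-- `f_b` is a primitive binomial of the ideal `I`. -/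
def IsPrimitiveIn (K : Type*) [Field K] {ι : Type*} [Fintype ι]
    (I : Ideal (MvPolynomial ι K)) (b : ι → ℤ) : Prop :=
  b ≠ 0 ∧ binom K b ∈ I ∧
    ∀ c : ι → ℤ, c ≠ 0 → binom K c ∈ I →
      binomPlus K c ∣ binomPlus K b → binomMinus K c ∣ binomMinus K b → c = b

/-- A (vertex-)weighted oriented graph: finite sets of vertices and edges, each
edge `e` oriented from `src e` to `tgt e`, no loops, no parallel edges, and a
positive integer weight attached to every vertex. -/
structure WOGraph (V E : Type*) where
  src : E → V
  tgt : E → V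
  w : V → ℕ
  no_loop : ∀ e, src e ≠ tgt e
  no_parallel : ∀ e e' : E, s(src e, tgt e) = s(src e', tgt e') → e = e'
  wpos : ∀ v, 0 < w v

namespace WOGraph

variable {V E : Type*}

/-- The toric ideal `I_D` of a weighted oriented graph: the kernel of
`K[e : e ∈ E(D)] → K[x : x ∈ V(D)]`, `e = (x_i,x_j) ↦ x_i x_j ^ w_j`. -/
noncomputable def toricIdeal (D : WOGraph V E) (K : Type*) [Field K] :
    Ideal (MvPolynomial E K) :=
  RingHom.ker (aeval (R := K)
    (fun e => X (D.src e) * X (D.tgt e) ^ D.w (D.tgt e)) :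
      MvPolynomial E K →ₐ[K] MvPolynomial V K).toRingHom

/-- The edge `e` is incident with the vertex `v`. -/
def incident (D : WOGraph V E) (v : V) (e : E) : Prop :=
  D.src e = v ∨ D.tgt e = v

/-- Degree of a vertex. -/
noncomputable def degree (D : WOGraph V E) (v : V) : ℕ :=
  Set.ncard {e : E | D.incident v e}

/-- A leaf is a vertex of degree 1. -/
def IsLeaf (D : WOGraph V E) (v : V) : Prop := D.degree v = 1

/-- A sink is a vertex of outdegree 0. -/
def IsSink (D : WOGraph V E) (v : V) : Prop := ∀ e, D.src e ≠ v

/-- The Graver basis `Gr_D`: the set of primitive binomials of `I_D`. -/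
def graverSet (D : WOGraph V E) (K : Type*) [Field K] [Fintype E] :
    Set (MvPolynomial E K) :=
  {f | ∃ b : E → ℤ, f = binom K b ∧ IsPrimitiveIn K (D.toricIdeal K) b}

/-- The set `C_D` of circuits of `I_D`: irreducible binomials of `I_D` with
minimal support. -/
def circuitSet (D : WOGraph V E) (K : Type*) [Field K] [Fintype E] :
    Set (MvPolynomial E K) :=
  {f | ∃ b : E → ℤ, f = binom K b ∧ b ≠ 0 ∧ binom K b ∈ D.toricIdeal K ∧
      (Finset.univ.gcd fun e => (b e).natAbs) = 1 ∧
      ∀ c : E → ℤ, c ≠ 0 → binom K c ∈ D.toricIdeal K →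
        vsupp c ⊆ vsupp b → vsupp c = vsupp b}

/-- Cyclic successor on `Fin n`. -/
def finRot {n : ℕ} (i : Fin n) : Fin n := ⟨((i : ℕ) + 1) % n, Nat.mod_lt _ i.pos⟩

/-- A cycle of length `n ≥ 3` in a weighted oriented graph `D`, with its usual
labelling: the edge `edge i` joins the vertices `vert i` and `vert (i+1)`
(indices cyclically). -/
structure CycleIn (D : WOGraph V E) where
  n : ℕ
  hn : 3 ≤ n
  vert : Fin n → V
  edge : Fin n → E
  vinj : Function.Injective vert
  einj : Function.Injective edge
  hinc : ∀ i : Fin n, s(D.src (edge i), D.tgt (edge i)) = s(vert i, vert (finRot i))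

/-- A path of length `k ≥ 1` in `D`, with its usual labelling: the edge `edge i`
joins `vert i` and `vert (i+1)`. -/
structure PathIn (D : WOGraph V E) where
  k : ℕ
  hk : 1 ≤ k
  vert : Fin (k + 1) → V
  edge : Fin k → E
  vinj : Function.Injective vert
  einj : Function.Injective edge
  hinc : ∀ i : Fin k, s(D.src (edge i), D.tgt (edge i)) = s(vert i.castSucc, vert i.succ)

variable [DecidableEq V]

/-- The incidence entry of a vertex `v` and an edge `e`: `1` if `e` leaves `v`,
`w v` if `e` enters `v`, `0` otherwise. -/
def inc (D : WOGraph V E) (v : V) (e : E) : ℤ :=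
  if D.src e = v then 1 else if D.tgt e = v then (D.w v : ℤ) else 0

/-- The incidence matrix of a cycle in `D` (with respect to its usual labelling). -/
def CycleIn.mat {D : WOGraph V E} (C : CycleIn D) : Matrix (Fin C.n) (Fin C.n) ℤ :=
  fun i j => D.inc (C.vert i) (C.edge j)

/-- A cycle is balanced if its incidence matrix is singular. -/
def CycleIn.IsBalanced {D : WOGraph V E} (C : CycleIn D) : Prop := C.mat.det = 0

/-- A cycle is unbalanced if its incidence matrix is nonsingular. -/
def CycleIn.IsUnbalanced {D : WOGraph V E} (C : CycleIn D) : Prop := C.mat.det ≠ 0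

end WOGraph

namespace WOGraph

variable {V E : Type*}

/-- Two cycles share exactly one vertex. -/
def ShareOneVertex {D : WOGraph V E} (C₁ C₂ : CycleIn D) : Prop :=
  (∃ v : V, Set.range C₁.vert ∩ Set.range C₂.vert = {v}) ∧
    Set.range C₁.edge ∩ Set.range C₂.edge = ∅

/-- Two cycles share the path `P`. -/
def SharePath {D : WOGraph V E} (C₁ C₂ : CycleIn D) (P : PathIn D) : Prop :=
  Set.range P.edge ⊆ Set.range C₁.edge ∧ Set.range P.edge ⊆ Set.range C₂.edge ∧
    Set.range C₁.edge ∩ Set.range C₂.edge = Set.range P.edge ∧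
    Set.range C₁.vert ∩ Set.range C₂.vert = Set.range P.vert

/-- Two (disjoint) cycles are connected by the path `P`, which meets `C₁` only in
its first vertex and `C₂` only in its last vertex. -/
def ConnectedByPath {D : WOGraph V E} (C₁ C₂ : CycleIn D) (P : PathIn D) : Prop :=
  Set.range C₁.vert ∩ Set.range C₂.vert = ∅ ∧
    P.vert 0 ∈ Set.range C₁.vert ∧ P.vert (Fin.last P.k) ∈ Set.range C₂.vert ∧
    (∀ i : Fin (P.k + 1), i ≠ 0 → P.vert i ∉ Set.range C₁.vert) ∧
    (∀ i : Fin (P.k + 1), i ≠ Fin.last P.k → P.vert i ∉ Set.range C₂.vert) ∧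
    Set.range P.edge ∩ (Set.range C₁.edge ∪ Set.range C₂.edge) = ∅

/-- `f` is the primitive binomial generator of the (principal) toric ideal of the
subgraph of `D` with edge set `S` (identified with the binomials of `I_D`
supported in `S`). -/
def IsPrimGenOn (D : WOGraph V E) (K : Type*) [Field K] [Fintype E]
    (S : Set E) (f : MvPolynomial E K) : Prop :=
  ∃ b : E → ℤ, f = binom K b ∧ b ≠ 0 ∧ vsupp b ⊆ S ∧ binom K b ∈ D.toricIdeal K ∧
    (∀ c : E → ℤ, c ≠ 0 → vsupp c ⊆ S → binom K c ∈ D.toricIdeal K →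
      binomPlus K c ∣ binomPlus K b → binomMinus K c ∣ binomMinus K b → c = b) ∧
    (∀ g : MvPolynomial E K, g ∈ D.toricIdeal K →
      (∀ m ∈ g.support, ∀ e : E, m e ≠ 0 → e ∈ S) → g ∈ Ideal.span {f})

end WOGraph

/-- A leaf is incident with only one edge. -/
theorem WOGraph.IsLeaf.eq_of_incident {V E : Type*} {D : WOGraph V E} {v : V}
    (hv : D.IsLeaf v) {e e' : E} (he : D.incident v e) (he' : D.incident v e') : e' = e := by
  obtain ⟨a, ha⟩ := Set.ncard_eq_one.mp (show Set.ncard {e : E | D.incident v e} = 1 from hv)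
  have h : ∀ x, D.incident v x → x = a := fun x hx =>
    (Set.ext_iff.mp ha x).mp hx
  rw [h e he, h e' he']

/-- Membership in the toric ideal, specialised along a point of a polynomial ring. -/
theorem WOGraph.aeval_prod_eq_of_binom_mem {V E : Type*} [Fintype E] {K : Type*} [Field K]
    {D : WOGraph V E} {b : E → ℤ} (hb : binom K b ∈ D.toricIdeal K)
    {A : Type*} [CommRing A] [Algebra K A] (x : V → A) :
    ∏ e, (x (D.src e) * x (D.tgt e) ^ D.w (D.tgt e)) ^ (b e).toNat =
      ∏ e, (x (D.src e) * x (D.tgt e) ^ D.w (D.tgt e)) ^ (-b e).toNat := by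
  have h : aeval (R := K) (fun e => (X (D.src e) * X (D.tgt e) ^ D.w (D.tgt e) :
      MvPolynomial V K)) (binom K b) = 0 := hb
  have h' := congrArg (aeval (R := K) x) h
  simpa [binom, binomPlus, binomMinus, sub_eq_zero] using h'

/-- Lemma 3.1. Let `D` be a weighted oriented graph and
`f_b ∈ I_D` a pure binomial. Then `supp(f_b)` contains no edge incident with a
leaf of `D`. -/
theorem stmt0 {V E : Type*} [Fintype V] [Fintype E] (K : Type*) [Field K]
    (D : WOGraph V E) (b : E → ℤ) (hb : binom K b ∈ D.toricIdeal K) :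
    ∀ e : E, ∀ v : V, D.IsLeaf v → D.incident v e → b e = 0 := by
  classical
  intro e v hv he
  have key := WOGraph.aeval_prod_eq_of_binom_mem hb
    (fun u => if u = v then (Polynomial.X : Polynomial K) else 1)
  have hone : ∀ e' ≠ e, D.src e' ≠ v ∧ D.tgt e' ≠ v := fun e' hne =>
    ⟨fun h => hne (hv.eq_of_incident he (Or.inl h)),
      fun h => hne (hv.eq_of_incident he (Or.inr h))⟩
  rw [Finset.prod_eq_single e (fun e' _ hne => by simp [hone e' hne]) (by simp),
    Finset.prod_eq_single e (fun e' _ hne => by simp [hone e' hne]) (by simp)] at key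
  have hnat : (b e).toNat = (-b e).toNat := by
    rcases he with h | h
    · have h' : D.tgt e ≠ v := fun h' => D.no_loop e (h.trans h'.symm)
      simpa [h, h'] using congrArg Polynomial.natDegree key
    · have h' : D.src e ≠ v := fun h' => D.no_loop e (h'.trans h.symm)
      simpa [h, h', (D.wpos v).ne'] using congrArg Polynomial.natDegree key
  omega
end

section
/- Let D be a weighted oriented graph, let f_m ∈ I_D be a nonzero pure binomial, and let v be a vertex of D of degree n. (1) If n−1 of the edges of D incident with v are not in supp(f_m), then the remaining edge incident with v is also not in supp(f_m). (2) If an edge e_i incident with v belongs to supp(f_m^+) (respectively supp(f_m^-)), then there exists an edge e_j incident with v belonging to supp(f_m^-) (respectively supp(f_m^+)). -/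
open MvPolynomial Finset

namespace WOGraph

variable {V E : Type*}

open Classical in
/-- The exponent of the variable `v` in the monomial attached to the edge `e`. -/
noncomputable def edgeExponent (D : WOGraph V E) (v : V) (e : E) : ℕ :=
  (if D.src e = v then 1 else 0) + (if D.tgt e = v then D.w (D.tgt e) else 0)

theorem edgeExponent_pos_iff (D : WOGraph V E) (v : V) (e : E) :
    0 < D.edgeExponent v e ↔ D.incident v e := by
  have hw := D.wpos (D.tgt e)
  unfold edgeExponent incident
  split_ifs <;> simp_all

/-- The exponent vector of a binomial of the toric ideal is orthogonal to every row of the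
incidence matrix. -/
theorem sum_edgeExponent_mul_eq_zero [Fintype E] {K : Type*} [Field K] (D : WOGraph V E)
    {b : E → ℤ} (hb : binom K b ∈ D.toricIdeal K) (v : V) :
    ∑ e, (D.edgeExponent v e : ℤ) * b e = 0 := by
  classical
  let ψ : MvPolynomial V K →ₐ[K] Polynomial K := aeval fun u => if u = v then Polynomial.X else 1
  have hψ (e : E) : ψ (X (D.src e) * X (D.tgt e) ^ D.w (D.tgt e)) =
      Polynomial.X ^ D.edgeExponent v e := by
    simp only [ψ, edgeExponent, map_mul, map_pow, aeval_X, pow_add]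
    split_ifs <;> simp
  have hker : aeval (fun e => X (D.src e) * X (D.tgt e) ^ D.w (D.tgt e) : E → MvPolynomial V K)
      (binom K b) = 0 := hb
  have hX := congrArg ψ hker
  simp only [binom, binomPlus, binomMinus, map_sub, map_prod, map_pow, aeval_X, hψ, map_zero,
    sub_eq_zero, ← pow_mul, prod_pow_eq_pow_sum] at hX
  have hdeg := congrArg Polynomial.natDegree hX
  simp only [Polynomial.natDegree_X_pow] at hdeg
  have hcast : ∑ e, (D.edgeExponent v e : ℤ) * ((b e).toNat : ℤ) =
      ∑ e, (D.edgeExponent v e : ℤ) * ((-b e).toNat : ℤ) := by exact_mod_cast hdeg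
  rw [← sub_eq_zero, ← sum_sub_distrib] at hcast
  rw [← hcast]
  refine sum_congr rfl fun e _ => ?_
  rw [← mul_sub, Int.toNat_sub_toNat_neg]

/-- A nonnegative-on-`v` vector orthogonal to the row of `v` vanishes on the edges at `v`. -/
theorem eq_zero_of_forall_incident_nonneg [Fintype E] (D : WOGraph V E) {b : E → ℤ} {v : V}
    (hsum : ∑ e, (D.edgeExponent v e : ℤ) * b e = 0)
    (hnonneg : ∀ e, D.incident v e → 0 ≤ b e) {e : E} (he : D.incident v e) : b e = 0 := by
  have hterm (e' : E) : 0 ≤ (D.edgeExponent v e' : ℤ) * b e' := by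
    rcases Nat.eq_zero_or_pos (D.edgeExponent v e') with h | h
    · simp [h]
    · exact mul_nonneg (Int.natCast_nonneg _) (hnonneg e' ((D.edgeExponent_pos_iff v e').1 h))
  have hzero := (sum_eq_zero_iff_of_nonneg fun e' _ => hterm e').1 hsum e (mem_univ e)
  have hpos := (D.edgeExponent_pos_iff v e).2 he
  exact (mul_eq_zero.1 hzero).resolve_left (by exact_mod_cast hpos.ne')

end WOGraph

/-- Lemma 3.2. Let `f_b ≠ 0` be a pure binomial of `I_D` and
`v` a vertex of `D` of degree `n`.
(1) If all but one of the edges incident with `v` are outside `supp(f_b)`, then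
so is the remaining one.
(2) If an edge incident with `v` lies in `supp(f_b⁺)` (resp. `supp(f_b⁻)`), then
some edge incident with `v` lies in `supp(f_b⁻)` (resp. `supp(f_b⁺)`). -/
theorem stmt1 {V E : Type*} [Fintype V] [Fintype E] (K : Type*) [Field K]
    (D : WOGraph V E) (b : E → ℤ) (hb0 : b ≠ 0)
    (hb : binom K b ∈ D.toricIdeal K) (v : V) (n : ℕ) (hdeg : D.degree v = n) :
    (∀ e : E, D.incident v e →
        (∀ e' : E, D.incident v e' → e' ≠ e → b e' = 0) → b e = 0) ∧
    (∀ e : E, D.incident v e → 0 < b e →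
        ∃ e' : E, D.incident v e' ∧ b e' < 0) ∧
    (∀ e : E, D.incident v e → b e < 0 →
        ∃ e' : E, D.incident v e' ∧ 0 < b e') := by
  have hsum := D.sum_edgeExponent_mul_eq_zero hb v
  have hsum' : ∑ e, (D.edgeExponent v e : ℤ) * (-b) e = 0 := by simpa using hsum
  have hneg : ∀ e : E, D.incident v e → 0 < b e → ∃ e' : E, D.incident v e' ∧ b e' < 0 := by
    intro e he hpos
    by_contra! h
    exact hpos.ne' (D.eq_zero_of_forall_incident_nonneg hsum h he)
  have hpos : ∀ e : E, D.incident v e → b e < 0 → ∃ e' : E, D.incident v e' ∧ 0 < b e' := by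
    intro e he hlt
    by_contra! h
    have := D.eq_zero_of_forall_incident_nonneg hsum' (fun e' he' => neg_nonneg.2 (h e' he')) he
    exact hlt.ne (neg_eq_zero.1 this)
  refine ⟨fun e he hzero => ?_, hneg, hpos⟩
  rcases lt_trichotomy (b e) 0 with h | h | h
  · obtain ⟨e', he', h'⟩ := hpos e he h
    have := hzero e' he' (by rintro rfl; exact h.not_gt h')
    exact absurd this h'.ne'
  · exact h
  · obtain ⟨e', he', h'⟩ := hneg e he h
    have := hzero e' he' (by rintro rfl; exact h.not_gt h')
    exact absurd this h'.ne
end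

section
/- Let D be a weighted oriented graph. The set C_D of circuit binomials of the toric ideal I_D is exactly the union of the following four sets: (i) the primitive binomial generators f_c of the (principal) toric ideals I_C of balanced cycles C in D; (ii) the primitive binomial generators of the (principal) toric ideals of subgraphs of D consisting of two unbalanced cycles sharing exactly one vertex; (iii) the primitive binomial generators of the (principal) toric ideals of subgraphs of D consisting of two unbalanced cycles sharing a path; (iv) the primitive binomial generators of the (principal) toric ideals of subgraphs of D consisting of two unbalanced cycles connected by a path. -/
open MvPolynomial Finset

namespace WOGraph

lemma mem_toricIdeal {V E : Type*} {D : WOGraph V E} {K : Type*} [Field K]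
    {g : MvPolynomial E K} :
    g ∈ D.toricIdeal K ↔
      (aeval (R := K) (fun e => X (D.src e) * X (D.tgt e) ^ D.w (D.tgt e)) :
        MvPolynomial E K →ₐ[K] MvPolynomial V K) g = 0 := Iff.rfl

end WOGraph

section BinomialKernel

variable {V E : Type*} [Fintype E]

/-- The exponent vector of the positive part of `b`. -/
noncomputable def posExp {ι : Type*} [Fintype ι] (b : ι → ℤ) : ι →₀ ℕ :=
  Finsupp.equivFunOnFinite.symm fun e => (b e).toNat

@[simp] lemma posExp_apply {ι : Type*} [Fintype ι] (b : ι → ℤ) (e : ι) :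
    posExp b e = (b e).toNat := rfl

lemma binomPlus_eq (K : Type*) [Field K] {ι : Type*} [Fintype ι] (b : ι → ℤ) :
    binomPlus K b = monomial (posExp b) 1 := by
  rw [monomial_eq, Finsupp.prod_fintype _ _ (by simp)]
  simp [binomPlus]

lemma binomMinus_eq (K : Type*) [Field K] {ι : Type*} [Fintype ι] (b : ι → ℤ) :
    binomMinus K b = monomial (posExp (-b)) 1 := by
  rw [monomial_eq, Finsupp.prod_fintype _ _ (by simp)]
  simp [binomMinus]

lemma binom_eq (K : Type*) [Field K] {ι : Type*} [Fintype ι] (b : ι → ℤ) :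
    binom K b = monomial (posExp b) 1 - monomial (posExp (-b)) 1 := by
  rw [binom, binomPlus_eq, binomMinus_eq]

lemma posExp_ne_posExp_neg {ι : Type*} [Fintype ι] {b : ι → ℤ} (hb : b ≠ 0) :
    posExp b ≠ posExp (-b) := by
  intro h
  apply hb
  funext e
  have := DFunLike.congr_fun h e
  simp only [posExp_apply, Pi.neg_apply] at this
  simp only [Pi.zero_apply]
  omega

lemma support_binom (K : Type*) [Field K] {ι : Type*} [Fintype ι] [DecidableEq ι] {b : ι → ℤ}
    (hb : b ≠ 0) : (binom K b).support = {posExp b, posExp (-b)} := by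
  have h := posExp_ne_posExp_neg hb
  ext m
  rw [mem_support_iff, binom_eq, coeff_sub, coeff_monomial, coeff_monomial]
  simp only [Finset.mem_insert, Finset.mem_singleton]
  by_cases h1 : posExp b = m
  · subst h1; simp [h.symm]
  · by_cases h2 : posExp (-b) = m
    · subst h2; simp [h]
    · simp [h1, h2, Ne.symm h1, Ne.symm h2]

lemma binom_ne_zero (K : Type*) [Field K] {ι : Type*} [Fintype ι] {b : ι → ℤ}
    (hb : b ≠ 0) : binom K b ≠ 0 := by
  classical
  rw [← support_nonempty, support_binom K hb]
  simp

lemma degreeOf_binom (K : Type*) [Field K] {ι : Type*} [Fintype ι] {b : ι → ℤ}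
    (hb : b ≠ 0) (e : ι) : degreeOf e (binom K b) = (b e).natAbs := by
  classical
  rw [degreeOf_eq_sup, support_binom K hb]
  simp only [Finset.sup_insert, Finset.sup_singleton, posExp_apply, Pi.neg_apply]
  omega

lemma natAbs_le_of_binom_mem_span {K : Type*} [Field K] {ι : Type*} [Fintype ι] {b c : ι → ℤ}
    (hb : b ≠ 0) (hc : c ≠ 0) (h : binom K c ∈ Ideal.span {binom K b}) (e : ι) :
    (b e).natAbs ≤ (c e).natAbs := by
  obtain ⟨g, hg⟩ := Ideal.mem_span_singleton.1 h
  have hg0 : g ≠ 0 := by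
    rintro rfl
    exact binom_ne_zero K hc (by simpa using hg)
  rw [← degreeOf_binom K hb, ← degreeOf_binom K hc, hg,
    degreeOf_mul_eq (binom_ne_zero K hb) hg0]
  exact Nat.le_add_right _ _

lemma monomial_one_dvd_iff {K : Type*} [Field K] {ι : Type*} {u v : ι →₀ ℕ} :
    (monomial u (1 : K) : MvPolynomial ι K) ∣ monomial v 1 ↔ u ≤ v := by
  rw [monomial_dvd_monomial]
  simp

namespace WOGraph

/-- The exponent vector of the image of a monomial in the vertex variables. -/
noncomputable def imageExp (D : WOGraph V E) (u : E →₀ ℕ) : V →₀ ℕ :=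
  ∑ e, u e • (Finsupp.single (D.src e) 1 + Finsupp.single (D.tgt e) (D.w (D.tgt e)))

lemma aeval_monomial_one (D : WOGraph V E) (K : Type*) [Field K] (u : E →₀ ℕ) (a : K) :
    (aeval (R := K) (fun e => X (D.src e) * X (D.tgt e) ^ D.w (D.tgt e)) :
      MvPolynomial E K →ₐ[K] MvPolynomial V K) (monomial u a) = monomial (D.imageExp u) a := by
  rw [aeval_monomial, Finsupp.prod_fintype _ _ (by simp), imageExp]
  have : ∀ e, (X (D.src e) * X (D.tgt e) ^ D.w (D.tgt e) : MvPolynomial V K) =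
      monomial (Finsupp.single (D.src e) 1 + Finsupp.single (D.tgt e) (D.w (D.tgt e))) 1 := by
    intro e
    rw [X_pow_eq_monomial, X, monomial_mul, one_mul]
  simp only [this, monomial_pow, one_pow, algebraMap_eq]
  rw [← monomial_sum_one, C_mul_monomial, mul_one]

variable [DecidableEq V]

/-- `b` lies in the integer kernel of the incidence matrix. -/
def InKer (D : WOGraph V E) (b : E → ℤ) : Prop := ∀ v, ∑ e, D.inc v e * b e = 0

lemma imageExp_apply (D : WOGraph V E) (u : E →₀ ℕ) (v : V) :
    (D.imageExp u v : ℤ) = ∑ e, D.inc v e * u e := by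
  rw [imageExp, Finsupp.finsetSum_apply, Nat.cast_sum]
  refine Finset.sum_congr rfl fun e _ => ?_
  have := D.no_loop e
  unfold inc
  by_cases h1 : D.src e = v
  · subst h1
    simp [this.symm]
  · by_cases h2 : D.tgt e = v
    · subst h2
      simp [this, mul_comm]
    · simp [h1, h2]

lemma imageExp_eq_iff (D : WOGraph V E) (u u' : E →₀ ℕ) :
    D.imageExp u = D.imageExp u' ↔ D.InKer fun e => (u e : ℤ) - u' e := by
  rw [DFunLike.ext_iff]
  refine forall_congr' fun v => ?_
  rw [← Nat.cast_inj (R := ℤ), imageExp_apply, imageExp_apply, ← sub_eq_zero,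
    ← Finset.sum_sub_distrib]
  simp only [mul_sub]

lemma binom_mem_toricIdeal {D : WOGraph V E} {K : Type*} [Field K] {b : E → ℤ} :
    binom K b ∈ D.toricIdeal K ↔ D.InKer b := by
  rw [mem_toricIdeal, binom_eq, map_sub, aeval_monomial_one, aeval_monomial_one, sub_eq_zero,
    monomial_left_inj one_ne_zero, imageExp_eq_iff]
  have : (fun e => ((posExp b e : ℕ) : ℤ) - (posExp (-b) e : ℕ)) = b := by
    funext e
    simp only [posExp_apply, Pi.neg_apply]
    omega
  rw [this]

lemma monomial_sub_mem_span_of_nonneg {K : Type*} [Field K] {b : E → ℤ} {u u' : E →₀ ℕ} (k : ℕ)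
    (h : ∀ e, (u e : ℤ) - u' e = k * b e) :
    (monomial u 1 - monomial u' 1 : MvPolynomial E K) ∈ Ideal.span {binom K b} := by
  have hu : u = u ⊓ u' + k • posExp b := by
    ext e
    have := h e
    simp only [Finsupp.add_apply, Finsupp.inf_apply, Finsupp.smul_apply, posExp_apply,
      smul_eq_mul]
    zify
    rw [Int.toNat_eq_max]
    rcases le_total 0 (b e) with hb | hb
    · have : 0 ≤ (k : ℤ) * b e := by positivity
      rw [max_eq_left hb]
      omega
    · have : (k : ℤ) * b e ≤ 0 := mul_nonpos_of_nonneg_of_nonpos (by positivity) hb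
      rw [max_eq_right hb]
      omega
  have hu' : u' = u ⊓ u' + k • posExp (-b) := by
    ext e
    have := h e
    simp only [Finsupp.add_apply, Finsupp.inf_apply, Finsupp.smul_apply, posExp_apply,
      smul_eq_mul, Pi.neg_apply]
    zify
    rw [Int.toNat_eq_max]
    rcases le_total 0 (b e) with hb | hb
    · have : 0 ≤ (k : ℤ) * b e := by positivity
      rw [max_eq_right (by omega)]
      omega
    · have : (k : ℤ) * b e ≤ 0 := mul_nonpos_of_nonneg_of_nonpos (by positivity) hb
      rw [max_eq_left (by omega), mul_neg]
      omega
  have e1 : (monomial u 1 : MvPolynomial E K) =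
      monomial (u ⊓ u') 1 * (monomial (posExp b) 1) ^ k := by
    conv_lhs => rw [hu]
    rw [monomial_pow, monomial_mul]
    simp
  have e2 : (monomial u' 1 : MvPolynomial E K) =
      monomial (u ⊓ u') 1 * (monomial (posExp (-b)) 1) ^ k := by
    conv_lhs => rw [hu']
    rw [monomial_pow, monomial_mul]
    simp
  rw [Ideal.mem_span_singleton, e1, e2, ← mul_sub, binom_eq]
  exact Dvd.dvd.mul_left (sub_dvd_pow_sub_pow _ _ _) _

lemma monomial_sub_mem_span {K : Type*} [Field K] {b : E → ℤ} {u u' : E →₀ ℕ} (k : ℤ)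
    (h : ∀ e, (u e : ℤ) - u' e = k * b e) :
    (monomial u 1 - monomial u' 1 : MvPolynomial E K) ∈ Ideal.span {binom K b} := by
  obtain ⟨n, rfl | rfl⟩ := k.eq_nat_or_neg
  · exact monomial_sub_mem_span_of_nonneg n h
  · rw [← neg_sub]
    refine neg_mem (monomial_sub_mem_span_of_nonneg n fun e => ?_)
    have := h e
    linarith

lemma mem_span_binom_of_mem_toricIdeal {D : WOGraph V E} {K : Type*} [Field K] {S : Set E}
    {b : E → ℤ} (hS : ∀ c : E → ℤ, vsupp c ⊆ S → D.InKer c → ∃ k : ℤ, ∀ e, c e = k * b e)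
    {g : MvPolynomial E K} (hg : g ∈ D.toricIdeal K)
    (hgS : ∀ m ∈ g.support, ∀ e : E, m e ≠ 0 → e ∈ S) : g ∈ Ideal.span {binom K b} := by
  classical
  let r : (V →₀ ℕ) → (E →₀ ℕ) := fun d =>
    if h : ∃ m ∈ g.support, D.imageExp m = d then h.choose else 0
  have hr : ∀ m ∈ g.support, r (D.imageExp m) ∈ g.support ∧
      D.imageExp (r (D.imageExp m)) = D.imageExp m := by
    intro m hm
    have h : ∃ m' ∈ g.support, D.imageExp m' = D.imageExp m := ⟨m, hm, rfl⟩
    simp only [r, dif_pos h]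
    exact h.choose_spec
  let L : MvPolynomial V K →ₗ[K] MvPolynomial E K :=
    (basisMonomials V K).constr K fun d => monomial (r d) 1
  have hL : ∀ d (a : K), L (monomial d a) = monomial (r d) a := by
    intro d a
    have h1 : (monomial d a : MvPolynomial V K) = a • basisMonomials V K d := by
      rw [coe_basisMonomials]; simp [smul_monomial]
    rw [h1, map_smul, Module.Basis.constr_basis]
    simp [smul_monomial]
  have hzero : ∑ m ∈ g.support, (monomial (r (D.imageExp m)) (coeff m g) : MvPolynomial E K)
      = 0 := by
    have h2 := congrArg L (mem_toricIdeal.1 hg)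
    conv_lhs at h2 => rw [g.as_sum]
    rw [map_sum, map_sum, map_zero] at h2
    simpa only [aeval_monomial_one, hL] using h2
  have hsum : g = ∑ m ∈ g.support, (monomial m (coeff m g) -
      monomial (r (D.imageExp m)) (coeff m g) : MvPolynomial E K) := by
    rw [Finset.sum_sub_distrib, hzero, sub_zero]
    exact g.as_sum
  rw [hsum]
  refine Ideal.sum_mem _ fun m hm => ?_
  obtain ⟨hm', him⟩ := hr m hm
  set m' := r (D.imageExp m)
  obtain ⟨k, hk⟩ := hS (fun e => (m e : ℤ) - m' e) (by
    intro e he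
    simp only [vsupp, Set.mem_ofPred_eq] at he
    by_cases h0 : m e = 0
    · exact hgS m' hm' e (by omega)
    · exact hgS m hm e h0) ((imageExp_eq_iff D m m').1 him.symm)
  have := Ideal.mul_mem_left _ (C (coeff m g)) (monomial_sub_mem_span (K := K) k hk)
  simpa [mul_sub, C_mul_monomial] using this

lemma InKer.smul_sub {D : WOGraph V E} {b c : E → ℤ} (hb : D.InKer b) (hc : D.InKer c) (x y : ℤ) :
    D.InKer fun e => x * c e - y * b e := by
  intro v
  have : ∑ e, D.inc v e * (x * c e - y * b e) =
      x * ∑ e, D.inc v e * c e - y * ∑ e, D.inc v e * b e := by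
    rw [Finset.mul_sum, Finset.mul_sum, ← Finset.sum_sub_distrib]
    exact Finset.sum_congr rfl fun e _ => by ring
  rw [this, hb v, hc v]
  simp

/-- `b` is a primitive vector in the kernel of the incidence matrix with minimal support. -/
structure IsCircuitVec (D : WOGraph V E) (b : E → ℤ) : Prop where
  ne_zero : b ≠ 0
  inKer : D.InKer b
  gcd_eq : (Finset.univ.gcd fun e => (b e).natAbs) = 1
  minimal : ∀ c : E → ℤ, c ≠ 0 → D.InKer c → vsupp c ⊆ vsupp b → vsupp c = vsupp b

lemma IsCircuitVec.exists_mul {D : WOGraph V E} {b : E → ℤ} (hb : D.IsCircuitVec b)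
    {c : E → ℤ} (hcb : vsupp c ⊆ vsupp b) (hc : D.InKer c) : ∃ k : ℤ, ∀ e, c e = k * b e := by
  obtain ⟨e₀, he₀⟩ := Function.ne_iff.1 hb.ne_zero
  have hd : (fun e => b e₀ * c e - c e₀ * b e) = 0 := by
    by_contra h
    have := hb.minimal _ h (hb.inKer.smul_sub hc _ _) (by
      intro e he
      simp only [vsupp, Set.mem_ofPred_eq] at he
      by_contra hbe
      have h1 : b e = 0 := by simpa [vsupp] using hbe
      have h2 : c e = 0 := by
        by_contra h'
        exact hbe (hcb h')
      simp [h1, h2] at he)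
    have h2 : e₀ ∈ vsupp b := he₀
    rw [← this] at h2
    simp only [vsupp, Set.mem_ofPred_eq] at h2
    exact h2 (by ring)
  have hd' : ∀ e, b e₀ * c e = c e₀ * b e := fun e => by
    have := congrFun hd e
    simp only [Pi.zero_apply] at this
    linarith
  have hdvd : (b e₀).natAbs ∣ (c e₀).natAbs := by
    have : (b e₀).natAbs ∣ Finset.univ.gcd fun e => (c e₀).natAbs * (b e).natAbs := by
      refine Finset.dvd_gcd fun e _ => ?_
      rw [← Int.natAbs_mul, ← hd' e, Int.natAbs_mul]
      exact dvd_mul_right _ _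
    rw [Finset.gcd_mul_left, hb.gcd_eq] at this
    simpa using this
  obtain ⟨k, hk⟩ := Int.natAbs_dvd_natAbs.1 hdvd
  refine ⟨k, fun e => mul_left_cancel₀ he₀ ?_⟩
  rw [hd' e, hk]
  ring

lemma IsCircuitVec.isPrimGenOn {D : WOGraph V E} {b : E → ℤ} (hb : D.IsCircuitVec b)
    (K : Type*) [Field K] : D.IsPrimGenOn K (vsupp b) (binom K b) := by
  refine ⟨b, rfl, hb.ne_zero, subset_rfl, binom_mem_toricIdeal.2 hb.inKer, ?_, ?_⟩
  · intro c hc0 hc hcI h1 h2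
    obtain ⟨k, hk⟩ := hb.exists_mul hc (binom_mem_toricIdeal.1 hcI)
    rw [binomPlus_eq, binomPlus_eq, monomial_one_dvd_iff] at h1
    rw [binomMinus_eq, binomMinus_eq, monomial_one_dvd_iff] at h2
    obtain ⟨e, he⟩ := Function.ne_iff.1 hc0
    have h1e := h1 e
    have h2e := h2 e
    have hke := hk e
    simp only [posExp_apply, Pi.neg_apply, Pi.zero_apply] at h1e h2e he
    have hk0 : k ≠ 0 := by
      rintro rfl
      simp at hke
      exact he hke
    have hk1 : k = 1 := by
      rcases lt_trichotomy (b e) 0 with hbe | hbe | hbe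
      · rcases lt_or_gt_of_ne hk0 with hkn | hkp
        · nlinarith [Int.toNat_of_nonneg (show 0 ≤ c e by nlinarith),
            show 0 < c e by nlinarith, show (c e).toNat = 0 by omega]
        · have : k * (-b e) ≤ 1 * (-b e) := by
            have : -c e ≤ -b e := by omega
            linarith
          have := le_of_mul_le_mul_right this (by omega)
          omega
      · simp [hbe] at hke
        exact absurd hke he
      · rcases lt_or_gt_of_ne hk0 with hkn | hkp
        · have : c e < 0 := by nlinarith
          omega
        · have : k * b e ≤ 1 * b e := by
            have : c e ≤ b e := by omega
            linarith
          have := le_of_mul_le_mul_right this hbe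
          omega
    funext e
    rw [hk e, hk1, one_mul]
  · intro g hg hgS
    exact mem_span_binom_of_mem_toricIdeal (fun c h1 h2 => hb.exists_mul h1 h2) hg hgS

lemma isCircuitVec_of_isPrimGenOn {D : WOGraph V E} {K : Type*} [Field K] {S : Set E}
    {f : MvPolynomial E K} (h : D.IsPrimGenOn K S f) :
    ∃ b : E → ℤ, f = binom K b ∧ D.IsCircuitVec b := by
  classical
  obtain ⟨b, rfl, hb0, hbS, hbI, -, hgen⟩ := h
  have key : ∀ c : E → ℤ, c ≠ 0 → vsupp c ⊆ S → D.InKer c → ∀ e, (b e).natAbs ≤ (c e).natAbs := by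
    intro c hc0 hcS hc
    refine natAbs_le_of_binom_mem_span (K := K) hb0 hc0
      (hgen _ (binom_mem_toricIdeal.2 hc) ?_)
    intro m hm e hme
    rw [support_binom K hc0] at hm
    apply hcS
    simp only [vsupp, Set.mem_ofPred_eq]
    simp only [Finset.mem_insert, Finset.mem_singleton] at hm
    rintro h0
    rcases hm with rfl | rfl <;> simp [h0] at hme
  refine ⟨b, rfl, hb0, binom_mem_toricIdeal.1 hbI, ?_, ?_⟩
  · set d := Finset.univ.gcd fun e => (b e).natAbs with hd
    obtain ⟨e₀, he₀⟩ := Function.ne_iff.1 hb0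
    have hdvd : ∀ e, (d : ℤ) ∣ b e := fun e =>
      Int.natCast_dvd.2 (Finset.gcd_dvd (Finset.mem_univ e))
    choose b' hb' using hdvd
    have hd0 : (d : ℤ) ≠ 0 := by
      intro h
      apply he₀
      rw [hb' e₀, h]; simp
    have h0 : b' ≠ 0 := by
      rintro rfl
      apply he₀
      rw [hb' e₀]; simp
    have hle := key b' h0 (fun e he => hbS (by
      simp only [vsupp, Set.mem_ofPred_eq] at he ⊢
      rw [hb' e]
      exact mul_ne_zero hd0 he)) (by
        intro v
        have := binom_mem_toricIdeal.1 hbI v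
        refine mul_left_cancel₀ hd0 ?_
        rw [mul_zero, ← this, Finset.mul_sum]
        refine Finset.sum_congr rfl fun e _ => ?_
        conv_rhs => rw [hb' e]
        ring) e₀
    rw [hb' e₀, Int.natAbs_mul, Int.natAbs_natCast] at hle
    have hb'0 : 0 < (b' e₀).natAbs := by
      rw [Int.natAbs_pos]
      intro h
      apply he₀
      rw [hb' e₀, h]; simp
    have : d ≤ 1 := by
      by_contra hlt
      nlinarith
    omega
  · intro c hc0 hc hcb
    refine subset_antisymm hcb fun e he => ?_
    have := key c hc0 (hcb.trans hbS) hc e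
    simp only [vsupp, Set.mem_ofPred_eq] at he ⊢
    omega

lemma mem_circuitSet {D : WOGraph V E} {K : Type*} [Field K] {f : MvPolynomial E K} :
    f ∈ D.circuitSet K ↔ ∃ b : E → ℤ, f = binom K b ∧ D.IsCircuitVec b := by
  constructor
  · rintro ⟨b, rfl, h0, hI, hg, hm⟩
    exact ⟨b, rfl, h0, binom_mem_toricIdeal.1 hI, hg, fun c h1 h2 h3 =>
      hm c h1 (binom_mem_toricIdeal.2 h2) h3⟩
  · rintro ⟨b, rfl, h0, hI, hg, hm⟩
    exact ⟨b, rfl, h0, binom_mem_toricIdeal.2 hI, hg, fun c h1 h2 h3 =>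
      hm c h1 (binom_mem_toricIdeal.1 h2) h3⟩

end WOGraph

end BinomialKernel

section IncidenceKernel

namespace WOGraph

variable {V E : Type*} {D : WOGraph V E}

lemma incident_iff {v : V} {e : E} {x y : V} (h : s(D.src e, D.tgt e) = s(x, y)) :
    D.incident v e ↔ v = x ∨ v = y := by
  rw [← Sym2.mem_iff, ← h, Sym2.mem_iff, incident, eq_comm, @eq_comm _ (D.tgt e)]

lemma ne_of_ends {e : E} {x y : V} (h : s(D.src e, D.tgt e) = s(x, y)) : x ≠ y := by
  have := D.no_loop e
  rw [Sym2.eq_iff] at h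
  grind

lemma CycleIn.incident_edge (C : CycleIn D) {v : V} {i : Fin C.n}
    (h : D.incident v (C.edge i)) : v ∈ Set.range C.vert := by
  rcases (incident_iff (C.hinc i)).1 h with rfl | rfl <;> exact Set.mem_range_self _

variable [DecidableEq V]

lemma inc_ne_zero {v : V} {e : E} (h : D.incident v e) : D.inc v e ≠ 0 := by
  unfold inc
  have := D.wpos v
  split_ifs with h1 h2
  · simp
  · omega
  · exact absurd h (by simp [incident, h1, h2])

lemma inc_eq_zero {v : V} {e : E} (h : ¬ D.incident v e) : D.inc v e = 0 := by
  simp only [incident, not_or] at h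
  simp [inc, h.1, h.2]

variable [Fintype E]

lemma InKer.exists_other_edge {b : E → ℤ} (hb : D.InKer b) {v : V} {e : E}
    (he : e ∈ vsupp b) (hv : D.incident v e) :
    ∃ e' ∈ vsupp b, e' ≠ e ∧ D.incident v e' := by
  by_contra! h
  have := hb v
  rw [Finset.sum_eq_single e] at this
  · exact mul_ne_zero (inc_ne_zero hv) he this
  · intro e' _ hne
    by_cases h0 : b e' = 0
    · rw [h0, mul_zero]
    · rw [inc_eq_zero (h e' h0 hne), zero_mul]
  · simp

lemma exists_inKer_of_card_lt {W : Finset V} {F : Finset E} (hlt : W.card < F.card)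
    (hend : ∀ e ∈ F, ∀ v, D.incident v e → v ∈ W) :
    ∃ c : E → ℤ, c ≠ 0 ∧ D.InKer c ∧ vsupp c ⊆ F := by
  classical
  let M : Matrix W F ℤ := fun v e => D.inc v e
  have hninj : ¬ Function.Injective M.mulVecLin := by
    intro h
    have := card_le_of_injective ℤ _ h
    simp at this
    omega
  rw [← LinearMap.ker_eq_bot, Submodule.eq_bot_iff] at hninj
  push Not at hninj
  obtain ⟨x, hx, hx0⟩ := hninj
  rw [LinearMap.mem_ker, Matrix.mulVecLin_apply] at hx
  refine ⟨fun e => if h : e ∈ F then x ⟨e, h⟩ else 0, ?_, ?_, ?_⟩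
  · intro h
    apply hx0
    funext e
    simpa using congrFun h e
  · intro v
    rw [← Finset.sum_subset (Finset.subset_univ F), ← Finset.sum_attach]
    · simp only [Finset.coe_mem, dif_pos]
      by_cases hv : v ∈ W
      · exact congrFun hx ⟨v, hv⟩
      · refine Finset.sum_eq_zero fun e _ => ?_
        rw [inc_eq_zero fun h => hv (hend e e.2 v h), zero_mul]
    · intro e _ he
      simp [he]
  · intro e he
    by_contra h
    exact he (dif_neg h)

lemma CycleIn.IsBalanced.exists_inKer {C : CycleIn D} (hC : C.IsBalanced) :
    ∃ c : E → ℤ, c ≠ 0 ∧ D.InKer c ∧ vsupp c ⊆ Set.range C.edge := by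
  classical
  obtain ⟨x, hx0, hx⟩ := Matrix.exists_mulVec_eq_zero_iff.2 hC
  have hval : ∀ i, (∑ j, if C.edge j = C.edge i then x j else 0) = x i := by
    intro i
    simp [C.einj.eq_iff]
  refine ⟨fun e => ∑ i, if C.edge i = e then x i else 0, ?_, ?_, ?_⟩
  · intro h
    apply hx0
    funext i
    rw [← hval i]
    exact congrFun h (C.edge i)
  · intro v
    have h1 : ∑ e, D.inc v e * (∑ i, if C.edge i = e then x i else 0) =
        ∑ i, D.inc v (C.edge i) * x i := by
      simp only [Finset.mul_sum]
      rw [Finset.sum_comm]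
      simp
    rw [h1]
    by_cases hv : v ∈ Set.range C.vert
    · obtain ⟨i, rfl⟩ := hv
      exact congrFun hx i
    · refine Finset.sum_eq_zero fun i _ => ?_
      rw [inc_eq_zero fun h => hv (C.incident_edge h), zero_mul]
  · intro e he
    by_contra h
    apply he
    refine Finset.sum_eq_zero fun i _ => if_neg ?_
    rintro rfl
    exact h ⟨i, rfl⟩

lemma CycleIn.IsUnbalanced.exists_edge {C : CycleIn D} (hC : C.IsUnbalanced) {b : E → ℤ}
    (hb : D.InKer b) (hCb : Set.range C.edge ⊆ vsupp b) :
    ∃ v ∈ Set.range C.vert, ∃ e ∈ vsupp b, e ∉ Set.range C.edge ∧ D.incident v e := by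
  classical
  by_contra! h
  apply hC
  rw [← Matrix.exists_mulVec_eq_zero_iff]
  refine ⟨fun i => b (C.edge i), ?_, ?_⟩
  · intro h0
    have hn := C.hn
    exact hCb ⟨⟨0, by omega⟩, rfl⟩ (congrFun h0 ⟨0, by omega⟩)
  · funext i
    refine Eq.trans ?_ (hb (C.vert i))
    have h2 : ∑ e, D.inc (C.vert i) e * b e =
        ∑ e ∈ Finset.univ.image C.edge, D.inc (C.vert i) e * b e := by
      symm
      refine Finset.sum_subset (Finset.subset_univ _) fun e _ he => ?_
      by_cases h0 : b e = 0
      · rw [h0, mul_zero]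
      · rw [inc_eq_zero (h _ ⟨i, rfl⟩ e h0 (by simpa using he)), zero_mul]
    rw [h2, Finset.sum_image C.einj.injOn]
    rfl

end WOGraph

end IncidenceKernel

section Walks

namespace WOGraph

variable {V E : Type*} {D : WOGraph V E}

/-- The cycle of `D` given by sequences of vertices and edges. -/
def CycleIn.ofSeq {n : ℕ} (hn : 3 ≤ n) (v : ℕ → V) (e : ℕ → E)
    (hv : ∀ i < n, ∀ j < i, v j ≠ v i) (hlast : v n = v 0)
    (he : ∀ i < n, s(D.src (e i), D.tgt (e i)) = s(v i, v (i + 1))) : CycleIn D where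
  n := n
  hn := hn
  vert i := v i
  edge i := e i
  vinj := by
    intro i j hij
    rcases lt_trichotomy i j with h | h | h
    · exact absurd hij (hv j j.2 i h)
    · exact h
    · exact absurd hij.symm (hv i i.2 j h)
  einj := by
    have key : ∀ i < n, ∀ j < i, e j ≠ e i := by
      intro i hi j hj hij
      have h1 := he i hi
      rw [← hij, he j (by omega), Sym2.eq_iff] at h1
      have h2 := hv i hi j hj
      obtain ⟨h3, h4⟩ := h1.resolve_left fun h => h2 h.1
      have h5 : i = j + 1 := by
        by_contra hne
        exact hv i hi (j + 1) (by omega) h4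
      by_cases h6 : i + 1 < n
      · exact hv (i + 1) h6 j (by omega) h3
      · have h7 : i + 1 = n := by omega
        rw [h7, hlast] at h3
        exact hv j (by omega) 0 (by omega) h3.symm
    intro i j hij
    rcases lt_trichotomy i j with h | h | h
    · exact absurd hij (key j j.2 i h)
    · exact h
    · exact absurd hij.symm (key i i.2 j h)
  hinc i := by
    rw [he i i.2]
    by_cases h : (i : ℕ) + 1 < n
    · simp [finRot, Nat.mod_eq_of_lt h]
    · have h7 : (i : ℕ) + 1 = n := by omega
      simp [finRot, h7, hlast]

/-- The path of `D` given by sequences of vertices and edges. -/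
def PathIn.ofSeq {k : ℕ} (hk : 1 ≤ k) (v : ℕ → V) (e : ℕ → E)
    (hv : ∀ i ≤ k, ∀ j < i, v j ≠ v i)
    (he : ∀ i < k, s(D.src (e i), D.tgt (e i)) = s(v i, v (i + 1))) : PathIn D where
  k := k
  hk := hk
  vert i := v i
  edge i := e i
  vinj := by
    intro i j hij
    rcases lt_trichotomy i j with h | h | h
    · exact absurd hij (hv j (by omega) i h)
    · exact h
    · exact absurd hij.symm (hv i (by omega) j h)
  einj := by
    have key : ∀ i < k, ∀ j < i, e j ≠ e i := by
      intro i hi j hj hij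
      have h1 := he i hi
      rw [← hij, he j (by omega), Sym2.eq_iff] at h1
      obtain ⟨h3, h4⟩ := h1.resolve_left fun h => hv i (by omega) j hj h.1
      exact hv (i + 1) (by omega) j (by omega) h3
    intro i j hij
    rcases lt_trichotomy i j with h | h | h
    · exact absurd hij (key j j.2 i h)
    · exact h
    · exact absurd hij.symm (key i i.2 j h)
  hinc i := by
    rw [he i i.2]
    simp

lemma range_fin_eq_image {α : Type*} (f : ℕ → α) (n : ℕ) :
    (Set.range fun i : Fin n => f i) = f '' Set.Iio n := by
  ext x
  constructor
  · rintro ⟨i, rfl⟩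
    exact ⟨i, i.2, rfl⟩
  · rintro ⟨i, hi, rfl⟩
    exact ⟨⟨i, hi⟩, rfl⟩

lemma CycleIn.exists_seq (C : CycleIn D) {v : V} (hv : v ∈ Set.range C.vert) :
    ∃ (c : ℕ → V) (d : ℕ → E), c 0 = v ∧ (∀ i < C.n, ∀ j < i, c j ≠ c i) ∧
      (∀ i, s(D.src (d i), D.tgt (d i)) = s(c i, c (i + 1))) ∧
      Set.range C.vert = c '' Set.Iio C.n ∧ Set.range C.edge = d '' Set.Iio C.n ∧
      ∀ i < C.n, ∀ j < i, d j ≠ d i := by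
  obtain ⟨s, rfl⟩ := hv
  have hn : 0 < C.n := s.pos
  let g : ℕ → Fin C.n := fun i => ⟨(s + i) % C.n, Nat.mod_lt _ hn⟩
  have hinj : ∀ i < C.n, ∀ j < i, g j ≠ g i := by
    intro i hi j hj h
    have h1 : (s + j) % C.n = (s + i) % C.n := congrArg Fin.val h
    have h2 : j % C.n = i % C.n := Nat.ModEq.add_left_cancel' (s : ℕ) h1
    rw [Nat.mod_eq_of_lt hi, Nat.mod_eq_of_lt (hj.trans hi)] at h2
    omega
  have hsurj : ∀ l, ∃ i < C.n, g i = l := by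
    intro l
    refine ⟨(l + (C.n - s)) % C.n, Nat.mod_lt _ hn, Fin.ext ?_⟩
    have : (s : ℕ) + (l + (C.n - s)) = l + C.n := by omega
    simp only [g, Nat.add_mod_mod, this, Nat.add_mod_right, Nat.mod_eq_of_lt l.2]
  refine ⟨fun i => C.vert (g i), fun i => C.edge (g i), ?_, ?_, ?_, ?_, ?_, ?_⟩
  · refine congrArg C.vert (Fin.ext ?_)
    simp [g, Nat.mod_eq_of_lt s.2]
  · intro i hi j hj h
    exact hinj i hi j hj (C.vinj h)
  · intro i
    rw [C.hinc]
    have : finRot (g i) = g (i + 1) := Fin.ext (by simp [finRot, g, add_assoc])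
    rw [this]
  · refine subset_antisymm ?_ (Set.image_subset_iff.2 fun i _ => ⟨g i, rfl⟩)
    rintro _ ⟨l, rfl⟩
    obtain ⟨i, hi, rfl⟩ := hsurj l
    exact ⟨i, hi, rfl⟩
  · refine subset_antisymm ?_ (Set.image_subset_iff.2 fun i _ => ⟨g i, rfl⟩)
    rintro _ ⟨l, rfl⟩
    obtain ⟨i, hi, rfl⟩ := hsurj l
    exact ⟨i, hi, rfl⟩
  · intro i hi j hj h
    exact hinj i hi j hj (C.einj h)

/-- A non-backtracking infinite walk in `D` with edges in `S`. -/
structure IsNBWalk (D : WOGraph V E) (S : Set E) (p : ℕ → V) (q : ℕ → E) : Prop where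
  mem : ∀ i, q i ∈ S
  ends : ∀ i, s(D.src (q i), D.tgt (q i)) = s(p i, p (i + 1))
  ne : ∀ i, q (i + 1) ≠ q i

lemma exists_isNBWalk {S : Set E}
    (hS : ∀ e ∈ S, ∀ v, D.incident v e → ∃ e' ∈ S, e' ≠ e ∧ D.incident v e')
    {v : V} {e : E} (he : e ∈ S) (hv : D.incident v e) :
    ∃ p q, D.IsNBWalk S p q ∧ p 0 = v ∧ q 0 = e := by
  let T := {x : V × E // x.2 ∈ S ∧ D.incident x.1 x.2}
  have hstep : ∀ x : T, ∃ y : T,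
      s(D.src x.1.2, D.tgt x.1.2) = s(x.1.1, y.1.1) ∧ y.1.2 ≠ x.1.2 := by
    rintro ⟨⟨u, f⟩, hf, hu⟩
    obtain ⟨u', hu'⟩ : ∃ u', s(D.src f, D.tgt f) = s(u, u') := by
      rcases hu with h | h
      · exact ⟨D.tgt f, by rw [h]⟩
      · exact ⟨D.src f, by rw [h, Sym2.eq_swap]⟩
    obtain ⟨f', hf', hne, hinc⟩ := hS f hf u' ((incident_iff hu').2 (Or.inr rfl))
    exact ⟨⟨⟨u', f'⟩, hf', hinc⟩, hu', hne⟩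
  choose nxt h1 h2 using hstep
  let seq : ℕ → T := fun i => nxt^[i] ⟨⟨v, e⟩, he, hv⟩
  have hseq : ∀ i, seq (i + 1) = nxt (seq i) := fun i => Function.iterate_succ_apply' _ _ _
  refine ⟨fun i => (seq i).1.1, fun i => (seq i).1.2, ⟨fun i => (seq i).2.1, ?_, ?_⟩, rfl, rfl⟩
  · intro i
    rw [hseq]
    exact h1 _
  · intro i
    rw [hseq]
    exact h2 _

lemma exists_first_return [Finite V] (p : ℕ → V) (Z : Set V) :
    ∃ m, 1 ≤ m ∧ (p m ∈ Z ∨ ∃ j < m, p j = p m) ∧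
      ∀ i, 1 ≤ i → i < m → p i ∉ Z ∧ ∀ j < i, p j ≠ p i := by
  classical
  have hex : ∃ m, 1 ≤ m ∧ (p m ∈ Z ∨ ∃ j < m, p j = p m) := by
    obtain ⟨i, j, hij, hne⟩ : ∃ i j, p i = p j ∧ i ≠ j := by
      have := not_injective_infinite_finite p
      simpa [Function.Injective] using this
    rcases lt_or_gt_of_ne hne with h | h
    · exact ⟨j, by omega, Or.inr ⟨i, h, hij⟩⟩
    · exact ⟨i, by omega, Or.inr ⟨j, h, hij.symm⟩⟩
  refine ⟨Nat.find hex, (Nat.find_spec hex).1, (Nat.find_spec hex).2, fun i h1 h2 => ?_⟩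
  have := Nat.find_min hex h2
  push Not at this
  exact this h1

namespace IsNBWalk

variable {S : Set E} {p : ℕ → V} {q : ℕ → E}

lemma add_three_le (h : D.IsNBWalk S p q) {j m : ℕ} (hj : j < m) (hp : p j = p m) :
    j + 3 ≤ m := by
  by_contra hlt
  obtain rfl | rfl : m = j + 1 ∨ m = j + 2 := by omega
  · exact ne_of_ends (h.ends j) hp
  · apply h.ne j
    apply D.no_parallel
    rw [h.ends, h.ends, hp, Sym2.eq_swap]

lemma edge_ne (h : D.IsNBWalk S p q) {m : ℕ} (hp : ∀ i < m, ∀ j < i, p j ≠ p i) :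
    ∀ i < m, ∀ j < i, q j ≠ q i := by
  intro i hi j hj hij
  have h1 := h.ends i
  rw [← hij, h.ends, Sym2.eq_iff] at h1
  obtain ⟨h3, h4⟩ := h1.resolve_left fun h => hp i hi j hj h.1
  have h5 : i = j + 1 := by
    by_contra hne
    exact hp i hi (j + 1) (by omega) h4
  subst h5
  exact h.ne j hij.symm

/-- The cycle closed by a walk returning to its `j`-th vertex. -/
def toCycle (h : D.IsNBWalk S p q) {j m : ℕ} (hp : ∀ i < m, ∀ j < i, p j ≠ p i)
    (hj : j < m) (hjm : p j = p m) : CycleIn D :=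
  CycleIn.ofSeq (n := m - j) (by have := h.add_three_le hj hjm; omega)
    (fun i => p (j + i)) (fun i => q (j + i))
    (fun i hi l hl => hp _ (by omega) _ (by omega))
    (by rw [Nat.add_sub_cancel' hj.le, add_zero, hjm]) fun i _ => h.ends (j + i)

lemma image_add_Iio {α : Type*} (f : ℕ → α) {j m : ℕ} :
    (fun i => f (j + i)) '' Set.Iio (m - j) = f '' Set.Ico j m := by
  ext x
  constructor
  · rintro ⟨i, hi, rfl⟩
    simp only [Set.mem_Iio] at hi
    exact ⟨j + i, ⟨by omega, by omega⟩, rfl⟩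
  · rintro ⟨i, ⟨h1, h2⟩, rfl⟩
    refine ⟨i - j, ?_, ?_⟩
    · simp only [Set.mem_Iio]
      omega
    · simp only
      rw [Nat.add_sub_cancel' h1]

lemma range_vert_toCycle (h : D.IsNBWalk S p q) {j m : ℕ} (hp : ∀ i < m, ∀ j < i, p j ≠ p i)
    (hj : j < m) (hjm : p j = p m) :
    Set.range (h.toCycle hp hj hjm).vert = p '' Set.Ico j m :=
  (range_fin_eq_image (fun i => p (j + i)) _).trans (image_add_Iio p)

lemma range_edge_toCycle (h : D.IsNBWalk S p q) {j m : ℕ} (hp : ∀ i < m, ∀ j < i, p j ≠ p i)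
    (hj : j < m) (hjm : p j = p m) :
    Set.range (h.toCycle hp hj hjm).edge = q '' Set.Ico j m :=
  (range_fin_eq_image (fun i => q (j + i)) _).trans (image_add_Iio q)

end IsNBWalk

end WOGraph

end Walks

section Handcuffs

namespace WOGraph

variable {V E : Type*} {D : WOGraph V E}

/-- `F` is the edge set of two cycles, the first being `C`, which share exactly one vertex, or
share a path, or are connected by a path. -/
def IsHandcuff (C : CycleIn D) (F : Set E) : Prop :=
  (∃ C₂ : CycleIn D, ShareOneVertex C C₂ ∧ Set.range C.edge ∪ Set.range C₂.edge = F) ∨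
  (∃ (C₂ : CycleIn D) (P : PathIn D), SharePath C C₂ P ∧
    Set.range C.edge ∪ Set.range C₂.edge = F) ∨
  ∃ (C₂ : CycleIn D) (P : PathIn D), ConnectedByPath C C₂ P ∧
    Set.range C.edge ∪ Set.range P.edge ∪ Set.range C₂.edge = F

/-- A walk leaving a cycle `C` along an edge outside `C`, up to its first return. -/
structure IsEar (C : CycleIn D) (p : ℕ → V) (q : ℕ → E) (m : ℕ) : Prop where
  one_le : 1 ≤ m
  start : p 0 ∈ Set.range C.vert
  start_edge : q 0 ∉ Set.range C.edge
  notMem : ∀ i, 1 ≤ i → i < m → p i ∉ Set.range C.vert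
  inj : ∀ i < m, ∀ j < i, p j ≠ p i

namespace IsEar

variable {C : CycleIn D} {S : Set E} {p : ℕ → V} {q : ℕ → E} {m : ℕ}

lemma edge_notMem (h : IsEar C p q m) (hw : D.IsNBWalk S p q) {i : ℕ} (hi : i < m) :
    q i ∉ Set.range C.edge := by
  rcases Nat.eq_zero_or_pos i with rfl | h0
  · exact h.start_edge
  · rintro ⟨l, hl⟩
    refine h.notMem i h0 hi (C.incident_edge (i := l) ?_)
    rw [hl]
    exact (incident_iff (hw.ends i)).2 (Or.inl rfl)

lemma isHandcuff_of_return (h : IsEar C p q m) (hw : D.IsNBWalk S p q) {j : ℕ} (hj : j < m)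
    (hjm : p j = p m) : IsHandcuff C (Set.range C.edge ∪ q '' Set.Iio m) := by
  have hE := hw.edge_ne h.inj
  rcases Nat.eq_zero_or_pos j with rfl | h0
  · refine Or.inl ⟨hw.toCycle h.inj hj hjm, ⟨⟨p 0, ?_⟩, ?_⟩, ?_⟩
    · rw [hw.range_vert_toCycle]
      ext x
      constructor
      · rintro ⟨hx, i, ⟨-, hi⟩, rfl⟩
        rcases Nat.eq_zero_or_pos i with rfl | hi0
        · rfl
        · exact absurd hx (h.notMem i hi0 hi)
      · rintro rfl
        exact ⟨h.start, 0, ⟨le_rfl, hj⟩, rfl⟩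
    · rw [hw.range_edge_toCycle, Set.eq_empty_iff_forall_notMem]
      rintro _ ⟨hx, i, ⟨-, hi⟩, rfl⟩
      exact h.edge_notMem hw hi hx
    · rw [hw.range_edge_toCycle]
      congr 2
      ext i
      simp
  · refine Or.inr (Or.inr ⟨hw.toCycle h.inj hj hjm,
      PathIn.ofSeq (k := j) h0 p q (fun i hi => h.inj i (by omega)) fun i _ => hw.ends i,
      ⟨?_, h.start, ?_, ?_, ?_, ?_⟩, ?_⟩)
    · rw [hw.range_vert_toCycle, Set.eq_empty_iff_forall_notMem]
      rintro _ ⟨hx, i, ⟨hi1, hi⟩, rfl⟩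
      exact h.notMem i (by omega) hi hx
    · rw [hw.range_vert_toCycle]
      exact ⟨j, ⟨le_rfl, hj⟩, rfl⟩
    · intro i hi
      have h1 : (i : ℕ) < j + 1 := i.2
      have h2 : (i : ℕ) ≠ 0 := fun h => hi (Fin.ext h)
      exact h.notMem i (by omega) (by omega)
    · intro i hi
      have h1 : (i : ℕ) < j + 1 := i.2
      have h2 : (i : ℕ) ≠ j := fun h => hi (Fin.ext h)
      rw [hw.range_vert_toCycle]
      rintro ⟨l, ⟨hl1, hl2⟩, hl⟩
      exact h.inj l hl2 i (by omega) hl.symm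
    · change (Set.range fun i : Fin j => q i) ∩ _ = _
      rw [hw.range_edge_toCycle, range_fin_eq_image q j, Set.eq_empty_iff_forall_notMem]
      rintro _ ⟨⟨i, hi, rfl⟩, hx | ⟨l, ⟨hl1, hl2⟩, hl⟩⟩
      · exact h.edge_notMem hw (lt_trans hi hj) hx
      · exact hE l hl2 i (lt_of_lt_of_le hi hl1) hl.symm
    · change _ ∪ (Set.range fun i : Fin j => q i) ∪ _ = _
      rw [hw.range_edge_toCycle, range_fin_eq_image q j, Set.union_assoc, ← Set.image_union,
        Set.Iio_union_Ico_eq_Iio hj.le]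

lemma isHandcuff_of_mem (h : IsEar C p q m) (hw : D.IsNBWalk S p q)
    (hm : p m ∈ Set.range C.vert) (hne : p m ≠ p 0) :
    IsHandcuff C (Set.range C.edge ∪ q '' Set.Iio m) := by
  obtain ⟨c, d, hc0, hcinj, hcd, hcv, hce, -⟩ := C.exists_seq h.start
  have hm1 := h.one_le
  obtain ⟨t, ht, htm⟩ : p m ∈ c '' Set.Iio C.n := hcv ▸ hm
  have htn : t < C.n := ht
  have ht0 : 0 < t := by
    rw [Nat.pos_iff_ne_zero]
    rintro rfl
    exact hne (htm.symm.trans hc0)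
  have hcZ : ∀ i < C.n, c i ∈ Set.range C.vert := fun i hi => hcv ▸ ⟨i, hi, rfl⟩
  have hdZ : ∀ i < C.n, d i ∈ Set.range C.edge := fun i hi => hce ▸ ⟨i, hi, rfl⟩
  have h3 : 3 ≤ t + m := by
    by_contra hlt
    obtain ⟨rfl, rfl⟩ : t = 1 ∧ m = 1 := by omega
    apply h.start_edge
    have : q 0 = d 0 := by
      apply D.no_parallel
      rw [hw.ends, hcd, hc0, htm]
    rw [this]
    exact hdZ 0 (by omega)
  let v : ℕ → V := fun i => if i ≤ t then c i else p (t + m - i)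
  let e : ℕ → E := fun i => if i < t then d i else q (t + m - 1 - i)
  have hvc : ∀ i ≤ t, v i = c i := fun i hi => if_pos hi
  have hvp : ∀ i, t ≤ i → v i = p (t + m - i) := by
    intro i hi
    rcases eq_or_lt_of_le hi with rfl | hi
    · rw [hvc _ le_rfl, htm, Nat.add_sub_cancel_left]
    · exact if_neg (by omega)
  have hed : ∀ i < t, e i = d i := fun i hi => if_pos hi
  have heq : ∀ i, t ≤ i → e i = q (t + m - 1 - i) := fun i hi => if_neg (by omega)
  have hvinj : ∀ i < t + m, ∀ j < i, v j ≠ v i := by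
    intro i hi j hj
    by_cases hit : i ≤ t
    · rw [hvc i hit, hvc j (by omega)]
      exact hcinj i (by omega) j hj
    · rw [hvp i (by omega)]
      by_cases hjt : j ≤ t
      · rw [hvc j hjt]
        intro heq
        exact h.notMem (t + m - i) (by omega) (by omega) (heq ▸ hcZ j (by omega))
      · rw [hvp j (by omega)]
        exact (h.inj _ (by omega) _ (by omega)).symm
  have hends : ∀ i < t + m, s(D.src (e i), D.tgt (e i)) = s(v i, v (i + 1)) := by
    intro i hi
    by_cases hit : i < t
    · rw [hed i hit, hvc i hit.le, hvc (i + 1) hit, hcd]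
    · have h1 : t + m - 1 - i + 1 = t + m - i := by omega
      have h2 : t + m - (i + 1) = t + m - 1 - i := by omega
      rw [heq i (by omega), hvp i (by omega), hvp (i + 1) (by omega), hw.ends, Sym2.eq_swap,
        h1, h2]
  have hvlast : v (t + m) = v 0 := by
    rw [hvp _ (by omega), hvc 0 (by omega), hc0, Nat.sub_self]
  have hvimage : v '' Set.Iio (t + m) = c '' Set.Iio (t + 1) ∪ p '' Set.Ico 1 m := by
    ext x
    constructor
    · rintro ⟨i, hi, rfl⟩
      simp only [Set.mem_Iio] at hi
      by_cases hit : i ≤ t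
      · exact Or.inl ⟨i, by simp only [Set.mem_Iio]; omega, (hvc i hit).symm⟩
      · exact Or.inr ⟨t + m - i, ⟨by omega, by omega⟩, (hvp i (by omega)).symm⟩
    · rintro (⟨i, hi, rfl⟩ | ⟨i, ⟨hi1, hi2⟩, rfl⟩)
      · simp only [Set.mem_Iio] at hi
        exact ⟨i, by simp only [Set.mem_Iio]; omega, hvc i (by omega)⟩
      · refine ⟨t + m - i, by simp only [Set.mem_Iio]; omega, ?_⟩
        rw [hvp _ (by omega), Nat.sub_sub_self (by omega)]
  have heimage : e '' Set.Iio (t + m) = d '' Set.Iio t ∪ q '' Set.Iio m := by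
    ext x
    constructor
    · rintro ⟨i, hi, rfl⟩
      simp only [Set.mem_Iio] at hi
      by_cases hit : i < t
      · exact Or.inl ⟨i, hit, (hed i hit).symm⟩
      · exact Or.inr ⟨t + m - 1 - i, by simp only [Set.mem_Iio]; omega,
          (heq i (by omega)).symm⟩
    · rintro (⟨i, hi, rfl⟩ | ⟨i, hi, rfl⟩)
      · simp only [Set.mem_Iio] at hi
        exact ⟨i, by simp only [Set.mem_Iio]; omega, hed i hi⟩
      · simp only [Set.mem_Iio] at hi
        refine ⟨t + m - 1 - i, by simp only [Set.mem_Iio]; omega, ?_⟩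
        rw [heq _ (by omega), Nat.sub_sub_self (by omega)]
  have hdsub : d '' Set.Iio t ⊆ Set.range C.edge := by
    rintro _ ⟨i, hi, rfl⟩
    exact hdZ i (lt_trans hi htn)
  let C₂ : CycleIn D := CycleIn.ofSeq h3 v e hvinj hvlast hends
  let P : PathIn D := PathIn.ofSeq (k := t) ht0 c d (fun i hi => hcinj i (by omega))
    fun i _ => hcd i
  have hC₂v : Set.range C₂.vert = c '' Set.Iio (t + 1) ∪ p '' Set.Ico 1 m :=
    (range_fin_eq_image v _).trans hvimage
  have hC₂e : Set.range C₂.edge = d '' Set.Iio t ∪ q '' Set.Iio m :=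
    (range_fin_eq_image e _).trans heimage
  have hPv : Set.range P.vert = c '' Set.Iio (t + 1) := range_fin_eq_image c _
  have hPe : Set.range P.edge = d '' Set.Iio t := range_fin_eq_image d _
  refine Or.inr (Or.inl ⟨C₂, P, ⟨?_, ?_, ?_, ?_⟩, ?_⟩)
  · rw [hPe]
    exact hdsub
  · rw [hPe, hC₂e]
    exact Set.subset_union_left
  · rw [hPe, hC₂e, Set.inter_union_distrib_left, Set.inter_eq_right.2 hdsub, Set.union_eq_left]
    rintro _ ⟨hx, i, hi, rfl⟩
    exact absurd hx (h.edge_notMem hw hi)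
  · rw [hPv, hC₂v, Set.inter_union_distrib_left, Set.inter_eq_right.2, Set.union_eq_left]
    · rintro _ ⟨hx, i, ⟨hi1, hi2⟩, rfl⟩
      exact absurd hx (h.notMem i hi1 hi2)
    · rintro _ ⟨i, hi, rfl⟩
      exact hcZ i (lt_of_lt_of_le hi htn)
  · rw [hC₂e, ← Set.union_assoc, Set.union_eq_left.2 hdsub]

lemma isHandcuff (h : IsEar C p q m) (hw : D.IsNBWalk S p q)
    (hm : p m ∈ Set.range C.vert ∨ ∃ j < m, p j = p m) :
    IsHandcuff C (Set.range C.edge ∪ q '' Set.Iio m) := by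
  by_cases hj : ∃ j < m, p j = p m
  · obtain ⟨j, hj, hjm⟩ := hj
    exact h.isHandcuff_of_return hw hj hjm
  · exact h.isHandcuff_of_mem hw (hm.resolve_right hj) fun h0 => hj ⟨0, h.one_le, h0.symm⟩

lemma exists_inKer [Fintype E] [DecidableEq V] (h : IsEar C p q m) (hw : D.IsNBWalk S p q)
    (hm : p m ∈ Set.range C.vert ∨ ∃ j < m, p j = p m) :
    ∃ c : E → ℤ, c ≠ 0 ∧ D.InKer c ∧ vsupp c ⊆ Set.range C.edge ∪ q '' Set.Iio m := by
  classical
  let W : Finset V := Finset.univ.image C.vert ∪ (Finset.Ico 1 m).image p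
  let F : Finset E := Finset.univ.image C.edge ∪ (Finset.range m).image q
  have hm1 := h.one_le
  have hWcard : W.card ≤ C.n + (m - 1) := by
    refine (Finset.card_union_le _ _).trans (add_le_add ?_ ?_)
    · exact Finset.card_image_le.trans (by simp)
    · exact Finset.card_image_le.trans (by simp)
  have hqinj : Set.InjOn q (Finset.range m) := by
    intro i hi j hj hij
    simp only [Finset.coe_range, Set.mem_Iio] at hi hj
    have hE := hw.edge_ne h.inj
    rcases lt_trichotomy i j with hlt | hlt | hlt
    · exact absurd hij (hE j hj i hlt)
    · exact hlt
    · exact absurd hij.symm (hE i hi j hlt)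
  have hFcard : F.card = C.n + m := by
    rw [Finset.card_union_of_disjoint, Finset.card_image_of_injective _ C.einj,
      Finset.card_image_of_injOn hqinj]
    · simp
    · rw [Finset.disjoint_left]
      intro x hx hx'
      obtain ⟨l, -, rfl⟩ := Finset.mem_image.1 hx
      obtain ⟨i, hi, hil⟩ := Finset.mem_image.1 hx'
      exact h.edge_notMem hw (Finset.mem_range.1 hi) ⟨l, hil.symm⟩
  have hCW : ∀ x ∈ Set.range C.vert, x ∈ W := by
    rintro _ ⟨i, rfl⟩
    simp [W]
  have hpW : ∀ i ≤ m, p i ∈ W := by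
    have hlt : ∀ i < m, p i ∈ W := by
      intro i hi
      rcases Nat.eq_zero_or_pos i with rfl | h0
      · exact hCW _ h.start
      · exact Finset.mem_union_right _ (Finset.mem_image_of_mem p (by simp; omega))
    intro i hi
    rcases eq_or_lt_of_le hi with rfl | hi
    · rcases hm with hm | ⟨j, hj, hjm⟩
      · exact hCW _ hm
      · exact hjm ▸ hlt j hj
    · exact hlt i hi
  obtain ⟨c, hc0, hc, hcF⟩ := exists_inKer_of_card_lt (D := D) (W := W) (F := F)
    (by omega) (by
      intro e he v hv
      rcases Finset.mem_union.1 he with he | he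
      · obtain ⟨l, -, rfl⟩ := Finset.mem_image.1 he
        exact hCW _ (C.incident_edge hv)
      · obtain ⟨i, hi, rfl⟩ := Finset.mem_image.1 he
        have := Finset.mem_range.1 hi
        rcases (incident_iff (hw.ends i)).1 hv with rfl | rfl
        · exact hpW i (by omega)
        · exact hpW (i + 1) (by omega))
  refine ⟨c, hc0, hc, hcF.trans ?_⟩
  simp [F]

end IsEar

lemma exists_cycle [Finite V] {S : Set E} (hne : S.Nonempty)
    (hS : ∀ e ∈ S, ∀ v, D.incident v e → ∃ e' ∈ S, e' ≠ e ∧ D.incident v e') :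
    ∃ C : CycleIn D, Set.range C.edge ⊆ S := by
  obtain ⟨e, he⟩ := hne
  obtain ⟨p, q, hw, -, -⟩ := exists_isNBWalk hS he (Or.inl rfl)
  obtain ⟨m, hm1, hm, hmin⟩ := exists_first_return p ∅
  obtain ⟨j, hj, hjm⟩ := hm.resolve_left (Set.notMem_empty _)
  have hinj : ∀ i < m, ∀ j < i, p j ≠ p i := fun i hi j hj => (hmin i (by omega) hi).2 j hj
  refine ⟨hw.toCycle hinj hj hjm, ?_⟩
  rw [hw.range_edge_toCycle]
  rintro _ ⟨i, -, rfl⟩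
  exact hw.mem i

lemma IsCircuitVec.vsupp_eq [Fintype E] [DecidableEq V] {b : E → ℤ} (hb : D.IsCircuitVec b)
    {F : Set E} (hF : F ⊆ vsupp b)
    (hc : ∃ c : E → ℤ, c ≠ 0 ∧ D.InKer c ∧ vsupp c ⊆ F) : vsupp b = F := by
  obtain ⟨c, hc0, hc, hcF⟩ := hc
  exact subset_antisymm ((hb.minimal c hc0 hc (hcF.trans hF)).symm.subset.trans hcF) hF

lemma IsCircuitVec.exists_cycle_or_handcuff [Finite V] [Fintype E] [DecidableEq V] {b : E → ℤ}
    (hb : D.IsCircuitVec b) :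
    (∃ C : CycleIn D, C.IsBalanced ∧ vsupp b = Set.range C.edge) ∨
    ((∀ C : CycleIn D, Set.range C.edge ⊆ vsupp b → C.IsUnbalanced) ∧
      ∃ C : CycleIn D, Set.range C.edge ⊆ vsupp b ∧ IsHandcuff C (vsupp b)) := by
  by_cases hbal : ∃ C : CycleIn D, C.IsBalanced ∧ Set.range C.edge ⊆ vsupp b
  · obtain ⟨C, hC, hCb⟩ := hbal
    exact Or.inl ⟨C, hC, hb.vsupp_eq hCb hC.exists_inKer⟩
  · have hunb : ∀ C : CycleIn D, Set.range C.edge ⊆ vsupp b → C.IsUnbalanced :=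
      fun C hC h => hbal ⟨C, h, hC⟩
    refine Or.inr ⟨hunb, ?_⟩
    have hS : ∀ e ∈ vsupp b, ∀ v, D.incident v e → ∃ e' ∈ vsupp b, e' ≠ e ∧ D.incident v e' :=
      fun e he v hv => hb.inKer.exists_other_edge he hv
    obtain ⟨C, hC⟩ := exists_cycle (Function.ne_iff.1 hb.ne_zero) hS
    obtain ⟨v, hv, e, he, heC, hve⟩ := (hunb C hC).exists_edge hb.inKer hC
    obtain ⟨p, q, hw, rfl, rfl⟩ := exists_isNBWalk hS he hve
    obtain ⟨m, hm1, hm, hmin⟩ := exists_first_return p (Set.range C.vert)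
    have hear : IsEar C p q m :=
      ⟨hm1, hv, heC, fun i h1 h2 => (hmin i h1 h2).1,
        fun i hi j hj => (hmin i (by omega) hi).2 j hj⟩
    have hsub : Set.range C.edge ∪ q '' Set.Iio m ⊆ vsupp b := by
      refine Set.union_subset hC ?_
      rintro _ ⟨i, -, rfl⟩
      exact hw.mem i
    refine ⟨C, hC, ?_⟩
    rw [hb.vsupp_eq hsub (hear.exists_inKer hw hm)]
    exact hear.isHandcuff hw hm

end WOGraph

end Handcuffs

open WOGraph in
/-- Theorem 3.4. The circuit binomials of `I_D` are exactly the
primitive binomial generators of the principal toric ideals of: (i) balanced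
cycles of `D`; (ii) pairs of unbalanced cycles of `D` sharing exactly one
vertex; (iii) pairs of unbalanced cycles of `D` sharing a path; (iv) pairs of
unbalanced cycles of `D` connected by a path. -/
theorem stmt2 {V E : Type*} [Fintype V] [Fintype E] [DecidableEq V]
    (K : Type*) [Field K] (D : WOGraph V E) :
    D.circuitSet K =
      {f | ∃ C : CycleIn D, C.IsBalanced ∧
        D.IsPrimGenOn K (Set.range C.edge) f} ∪
      {f | ∃ C₁ C₂ : CycleIn D, C₁.IsUnbalanced ∧ C₂.IsUnbalanced ∧
        ShareOneVertex C₁ C₂ ∧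
        D.IsPrimGenOn K (Set.range C₁.edge ∪ Set.range C₂.edge) f} ∪
      {f | ∃ (C₁ C₂ : CycleIn D) (P : PathIn D), C₁.IsUnbalanced ∧
        C₂.IsUnbalanced ∧ SharePath C₁ C₂ P ∧
        D.IsPrimGenOn K (Set.range C₁.edge ∪ Set.range C₂.edge) f} ∪
      {f | ∃ (C₁ C₂ : CycleIn D) (P : PathIn D), C₁.IsUnbalanced ∧
        C₂.IsUnbalanced ∧ ConnectedByPath C₁ C₂ P ∧
        D.IsPrimGenOn K
          (Set.range C₁.edge ∪ Set.range P.edge ∪ Set.range C₂.edge) f} := by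
  ext f
  rw [mem_circuitSet]
  constructor
  · rintro ⟨b, rfl, hb⟩
    have hgen := hb.isPrimGenOn K
    rcases hb.exists_cycle_or_handcuff with ⟨C, hC, h⟩ | ⟨hunb, C, hC, h⟩
    · rw [h] at hgen
      exact Or.inl (Or.inl (Or.inl ⟨C, hC, hgen⟩))
    · have hCu := hunb C hC
      rcases h with ⟨C₂, h, hF⟩ | ⟨C₂, P, h, hF⟩ | ⟨C₂, P, h, hF⟩
      · have hC₂ := hunb C₂ (hF ▸ Set.subset_union_right)
        exact Or.inl (Or.inl (Or.inr ⟨C, C₂, hCu, hC₂, h, hF.symm ▸ hgen⟩))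
      · have hC₂ := hunb C₂ (hF ▸ Set.subset_union_right)
        exact Or.inl (Or.inr ⟨C, C₂, P, hCu, hC₂, h, hF.symm ▸ hgen⟩)
      · have hC₂ := hunb C₂ (hF ▸ Set.subset_union_right)
        exact Or.inr ⟨C, C₂, P, hCu, hC₂, h, hF.symm ▸ hgen⟩
  · rintro (((⟨_, _, h⟩ | ⟨_, _, _, _, _, h⟩) | ⟨_, _, _, _, _, _, h⟩) | ⟨_, _, _, _, _, _, h⟩) <;>
      exact isCircuitVec_of_isPrimGenOn h
end
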